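/- Let p, q ∈ [1,∞] with q* the conjugate exponent of q, let λ > 0, and let δ_m(a,b) = max{‖u‖_a : u ∈ ℝ^m, ‖u‖_b = 1}. Then for every z ∈ ℝ^m and β ∈ ℝ^n, the maximum of ‖z + Δβ‖_p over all Δ ∈ ℝ^{m×n} with entrywise ℓ_q norm ‖Δ‖_{F_q} ≤ λ equals at most ‖z‖_p + λ·δ_m(p,q)·‖β‖_{q*}; moreover sup_{‖Δ‖_{F_q} ≤ λ} ‖Δβ‖_p = λ·δ_m(p,q)·‖β‖_{q*}. -/

import Mathlib

open scoped ENNReal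

noncomputable def lpNorm (p : ℝ≥0∞) {ι : Type*} [Fintype ι] (x : ι → ℝ) : ℝ :=
  ‖(WithLp.equiv p (ι → ℝ)).symm x‖

noncomputable def frobNorm (p : ℝ≥0∞) {m n : ℕ} (A : Matrix (Fin m) (Fin n) ℝ) : ℝ :=
  lpNorm p (fun ij : Fin m × Fin n => A ij.1 ij.2)

noncomputable def discrep (m : ℕ) (a b : ℝ≥0∞) : ℝ :=
  sSup {t : ℝ | ∃ u : Fin m → ℝ, lpNorm b u = 1 ∧ t = lpNorm a u}

section LpNorm

variable {ι κ : Type*} [Fintype ι] [Fintype κ] {p q qs : ℝ≥0∞}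

theorem lpNorm_top (x : ι → ℝ) : lpNorm ∞ x = ⨆ i, |x i| := by
  simp [lpNorm, PiLp.norm_eq_ciSup]

theorem lpNorm_eq_sum (hq : 0 < q.toReal) (x : ι → ℝ) :
    lpNorm q x = (∑ i, |x i| ^ q.toReal) ^ (1 / q.toReal) := by
  simp [lpNorm, PiLp.norm_eq_sum hq]

theorem toReal_pos_of_one_le (hq : 1 ≤ q) (hq' : q ≠ ∞) : 0 < q.toReal :=
  ENNReal.toReal_pos (zero_lt_one.trans_le hq).ne' hq'

theorem lpNorm_nonneg (hp : 1 ≤ p) (x : ι → ℝ) : 0 ≤ lpNorm p x :=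
  have : Fact (1 ≤ p) := ⟨hp⟩
  norm_nonneg (WithLp.toLp p x)

theorem lpNorm_add_le (hp : 1 ≤ p) (x y : ι → ℝ) :
    lpNorm p (x + y) ≤ lpNorm p x + lpNorm p y :=
  have : Fact (1 ≤ p) := ⟨hp⟩
  norm_add_le (WithLp.toLp p x) (WithLp.toLp p y)

theorem lpNorm_smul (hp : 1 ≤ p) (c : ℝ) (x : ι → ℝ) :
    lpNorm p (c • x) = |c| * lpNorm p x :=
  have : Fact (1 ≤ p) := ⟨hp⟩
  norm_smul c (WithLp.toLp p x)

theorem lpNorm_eq_zero (hp : 1 ≤ p) {x : ι → ℝ} (h : lpNorm p x = 0) : x = 0 := by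
  have : Fact (1 ≤ p) := ⟨hp⟩
  have := norm_eq_zero.1 (show ‖WithLp.toLp p x‖ = 0 from h)
  simpa using this

theorem lpNorm_zero (hp : 1 ≤ p) : lpNorm p (0 : ι → ℝ) = 0 := by
  have : Fact (1 ≤ p) := ⟨hp⟩
  exact norm_zero (E := PiLp p fun _ : ι => ℝ)

theorem abs_apply_le_lpNorm (hp : 1 ≤ p) (x : ι → ℝ) (i : ι) : |x i| ≤ lpNorm p x :=
  have : Fact (1 ≤ p) := ⟨hp⟩
  PiLp.norm_apply_le (WithLp.toLp p x) i

theorem lpNorm_le_sum (hp : 1 ≤ p) (x : ι → ℝ) : lpNorm p x ≤ ∑ i, |x i| := by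
  classical
  have : Fact (1 ≤ p) := ⟨hp⟩
  have h : WithLp.toLp p x = ∑ i, WithLp.toLp p (Pi.single i (x i)) := by
    rw [← WithLp.toLp_sum, Finset.univ_sum_single]
  calc lpNorm p x = ‖∑ i, WithLp.toLp p (Pi.single i (x i))‖ := congrArg norm h
    _ ≤ ∑ i, ‖WithLp.toLp p (Pi.single i (x i) : ι → ℝ)‖ := norm_sum_le _ _
    _ = ∑ i, |x i| := by simp

theorem lpNorm_mono (hq : 1 ≤ q) {x y : ι → ℝ} (h : ∀ i, |x i| ≤ |y i|) :
    lpNorm q x ≤ lpNorm q y := by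
  rcases eq_or_ne q ∞ with rfl | hq'
  · rw [lpNorm_top, lpNorm_top]
    exact ciSup_mono (Set.finite_range _).bddAbove h
  · have hpos := toReal_pos_of_one_le hq hq'
    rw [lpNorm_eq_sum hpos, lpNorm_eq_sum hpos]
    exact Real.rpow_le_rpow (by positivity)
      (Finset.sum_le_sum fun i _ => Real.rpow_le_rpow (abs_nonneg _) (h i) hpos.le)
      (by positivity)

theorem lpNorm_prod (hq : 1 ≤ q) (x : ι × κ → ℝ) :
    lpNorm q x = lpNorm q (fun i => lpNorm q fun k => x (i, k)) := by
  rcases eq_or_ne q ∞ with rfl | hq'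
  · refine le_antisymm ?_ ?_
    · rw [lpNorm_top]
      refine Real.iSup_le (fun ⟨i, k⟩ => ?_) (lpNorm_nonneg hq _)
      calc |x (i, k)| ≤ lpNorm ∞ fun k => x (i, k) :=
            abs_apply_le_lpNorm hq (fun k => x (i, k)) k
        _ ≤ |lpNorm ∞ fun k => x (i, k)| := le_abs_self _
        _ ≤ _ := abs_apply_le_lpNorm hq (fun i => lpNorm ∞ fun k => x (i, k)) i
    · rw [lpNorm_top]
      refine Real.iSup_le (fun i => ?_) (lpNorm_nonneg hq _)
      rw [abs_of_nonneg (lpNorm_nonneg hq _), lpNorm_top]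
      exact Real.iSup_le (fun k => abs_apply_le_lpNorm hq x (i, k)) (lpNorm_nonneg hq _)
  · have hpos := toReal_pos_of_one_le hq hq'
    rw [lpNorm_eq_sum hpos, lpNorm_eq_sum hpos, Fintype.sum_prod_type]
    congr 1
    refine Finset.sum_congr rfl fun i _ => ?_
    rw [abs_of_nonneg (lpNorm_nonneg hq _), lpNorm_eq_sum hpos, one_div,
      Real.rpow_inv_rpow (by positivity) hpos.ne']

theorem abs_sum_mul_le_lpNorm_one_mul_lpNorm_top (x y : ι → ℝ) :
    |∑ i, x i * y i| ≤ lpNorm 1 x * lpNorm ∞ y := by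
  have h1 : lpNorm 1 x = ∑ i, |x i| := by simp [lpNorm_eq_sum (q := 1) (by simp)]
  rw [h1, Finset.sum_mul]
  refine (Finset.abs_sum_le_sum_abs _ _).trans (Finset.sum_le_sum fun i _ => ?_)
  rw [abs_mul]
  exact mul_le_mul_of_nonneg_left (abs_apply_le_lpNorm le_top y i) (abs_nonneg _)

theorem conjugate_cases (hqs : 1 / q + 1 / qs = 1) :
    (q = 1 ∧ qs = ∞) ∨ (q = ∞ ∧ qs = 1) ∨
      (q ≠ ∞ ∧ qs ≠ ∞ ∧ qs.toReal.HolderConjugate q.toReal) := by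
  rw [one_div, one_div] at hqs
  rcases eq_or_ne q ∞ with rfl | hq
  · simp_all
  rcases eq_or_ne qs ∞ with rfl | hs
  · simp_all
  refine Or.inr (Or.inr ⟨hq, hs, ?_⟩)
  have hq0 : q ≠ 0 := by rintro rfl; simp at hqs
  have hs0 : qs ≠ 0 := by rintro rfl; simp at hqs
  have h := congrArg ENNReal.toReal hqs
  rw [ENNReal.toReal_add (by simpa) (by simpa), ENNReal.toReal_inv, ENNReal.toReal_inv,
    ENNReal.toReal_one, add_comm] at h
  exact ⟨by simpa using h, ENNReal.toReal_pos hs0 hs, ENNReal.toReal_pos hq0 hq⟩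

theorem one_le_of_conjugate (hqs : 1 / q + 1 / qs = 1) : 1 ≤ q := by
  rw [one_div, one_div] at hqs
  exact ENNReal.inv_le_one.1 (hqs ▸ le_self_add)

theorem abs_sum_mul_le_lpNorm_mul_lpNorm (hqs : 1 / q + 1 / qs = 1) (x y : ι → ℝ) :
    |∑ i, x i * y i| ≤ lpNorm q x * lpNorm qs y := by
  rcases conjugate_cases hqs with ⟨rfl, rfl⟩ | ⟨rfl, rfl⟩ | ⟨-, -, h⟩
  · exact abs_sum_mul_le_lpNorm_one_mul_lpNorm_top x y
  · simpa only [mul_comm] using abs_sum_mul_le_lpNorm_one_mul_lpNorm_top y x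
  · rw [lpNorm_eq_sum h.symm.pos, lpNorm_eq_sum h.pos]
    refine (Finset.abs_sum_le_sum_abs _ _).trans ?_
    simpa [abs_mul] using
      Real.inner_le_Lp_mul_Lq Finset.univ (fun i => |x i|) (fun i => |y i|) h.symm

theorem exists_lpNorm_le_one_sum_mul_eq (hqs : 1 / q + 1 / qs = 1) (y : ι → ℝ) :
    ∃ x : ι → ℝ, lpNorm q x ≤ 1 ∧ ∑ i, x i * y i = lpNorm qs y := by
  classical
  rcases conjugate_cases hqs with ⟨rfl, rfl⟩ | ⟨rfl, rfl⟩ | ⟨-, -, h⟩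
  · cases isEmpty_or_nonempty ι
    · exact ⟨0, by simp [lpNorm_zero], by simp [lpNorm_top]⟩
    · obtain ⟨i, hi⟩ := exists_eq_ciSup_of_finite (f := fun i => |y i|)
      refine ⟨Pi.single i (SignType.sign (y i) : ℝ), ?_, ?_⟩
      · refine (lpNorm_le_sum le_rfl _).trans ?_
        rw [Finset.sum_eq_single i (by simp +contextual) (by simp)]
        rcases lt_trichotomy (y i) 0 with hy | hy | hy <;> simp [hy]
      · rw [lpNorm_top, ← hi, Finset.sum_eq_single i (by simp +contextual) (by simp)]
        simp
  · refine ⟨fun i => (SignType.sign (y i) : ℝ), ?_, ?_⟩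
    · rw [lpNorm_top]
      refine Real.iSup_le (fun i => ?_) zero_le_one
      rcases lt_trichotomy (y i) 0 with hy | hy | hy <;> simp [hy]
    · simp [lpNorm_eq_sum (q := 1) (by simp)]
  · obtain ⟨g, hg, hgy⟩ := (NNReal.isGreatest_Lp Finset.univ (fun i => ‖y i‖₊) h).1
    refine ⟨fun i => (SignType.sign (y i) : ℝ) * g i, ?_, ?_⟩
    · have hle : lpNorm q (fun i => (g i : ℝ)) ≤ 1 := by
        rw [lpNorm_eq_sum h.symm.pos]
        refine Real.rpow_le_one (by positivity) ?_ (by have := h.symm.pos; positivity)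
        have hg' : ∑ i, g i ^ q.toReal ≤ 1 := hg
        simpa using NNReal.coe_le_coe.2 hg'
      refine (lpNorm_mono (one_le_of_conjugate hqs) fun i => ?_).trans hle
      rw [abs_mul]
      refine mul_le_of_le_one_left (abs_nonneg _) ?_
      rcases lt_trichotomy (y i) 0 with hy | hy | hy <;> simp [hy]
    · rw [lpNorm_eq_sum h.pos]
      have hgy' := congrArg NNReal.toReal hgy
      simp only [NNReal.coe_sum, NNReal.coe_mul, NNReal.coe_rpow, coe_nnnorm,
        Real.norm_eq_abs] at hgy'
      rw [← hgy']
      refine Finset.sum_congr rfl fun i _ => ?_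
      rw [mul_right_comm, sign_mul_self]

end LpNorm

section Matrix

variable {m n : ℕ} {p q qs : ℝ≥0∞}

theorem frobNorm_eq_lpNorm_rows (hq : 1 ≤ q) (A : Matrix (Fin m) (Fin n) ℝ) :
    frobNorm q A = lpNorm q (fun i => lpNorm q (A i)) :=
  lpNorm_prod hq _

theorem frobNorm_vecMulVec (hq : 1 ≤ q) (u : Fin m → ℝ) (v : Fin n → ℝ) :
    frobNorm q (Matrix.vecMulVec u v) = lpNorm q u * lpNorm q v := by
  have hrow : ∀ i, lpNorm q (Matrix.vecMulVec u v i) = |u i| * lpNorm q v := fun i =>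
    lpNorm_smul hq (u i) v
  have habs : lpNorm q (fun i => |u i|) = lpNorm q u :=
    le_antisymm (lpNorm_mono hq fun i => by simp) (lpNorm_mono hq fun i => by simp)
  have hsmul : (fun i => |u i| * lpNorm q v) = lpNorm q v • fun i => |u i| := by
    ext i; simp [mul_comm]
  rw [frobNorm_eq_lpNorm_rows hq]
  simp only [hrow]
  rw [hsmul, lpNorm_smul hq, habs, abs_of_nonneg (lpNorm_nonneg hq v), mul_comm]

theorem lpNorm_mulVec_le (hq : 1 ≤ q) (hqs : 1 / q + 1 / qs = 1)
    (A : Matrix (Fin m) (Fin n) ℝ) (β : Fin n → ℝ) :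
    lpNorm q (A.mulVec β) ≤ frobNorm q A * lpNorm qs β := by
  have h : ∀ i, |A.mulVec β i| ≤ |(lpNorm qs β • fun i => lpNorm q (A i)) i| := fun i =>
    calc |A.mulVec β i| ≤ lpNorm q (A i) * lpNorm qs β :=
          abs_sum_mul_le_lpNorm_mul_lpNorm hqs (A i) β
      _ ≤ |(lpNorm qs β • fun i => lpNorm q (A i)) i| := by
          rw [Pi.smul_apply, smul_eq_mul, mul_comm]
          exact le_abs_self _
  have hs : 1 ≤ qs := one_le_of_conjugate (by rwa [add_comm])
  refine (lpNorm_mono hq h).trans_eq ?_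
  rw [lpNorm_smul hq, frobNorm_eq_lpNorm_rows hq, abs_of_nonneg (lpNorm_nonneg hs β), mul_comm]

theorem discrep_nonneg (hp : 1 ≤ p) : 0 ≤ discrep m p q := by
  refine Real.sSup_nonneg ?_
  rintro t ⟨u, -, rfl⟩
  exact lpNorm_nonneg hp u

theorem bddAbove_discrep (hp : 1 ≤ p) (hq : 1 ≤ q) :
    BddAbove {t : ℝ | ∃ u : Fin m → ℝ, lpNorm q u = 1 ∧ t = lpNorm p u} := by
  refine ⟨∑ _i : Fin m, 1, ?_⟩
  rintro t ⟨u, hu, rfl⟩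
  exact (lpNorm_le_sum hp u).trans
    (Finset.sum_le_sum fun i _ => hu ▸ abs_apply_le_lpNorm hq u i)

theorem lpNorm_le_discrep_mul (hp : 1 ≤ p) (hq : 1 ≤ q) (u : Fin m → ℝ) :
    lpNorm p u ≤ discrep m p q * lpNorm q u := by
  rcases (lpNorm_nonneg hq u).eq_or_lt with h | h
  · rw [lpNorm_eq_zero hq h.symm, lpNorm_zero hp, lpNorm_zero hq, mul_zero]
  · have hmem : (lpNorm q u)⁻¹ * lpNorm p u ≤ discrep m p q := by
      refine le_csSup (bddAbove_discrep hp hq) ⟨(lpNorm q u)⁻¹ • u, ?_, ?_⟩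
      · rw [lpNorm_smul hq, abs_of_pos (inv_pos.2 h), inv_mul_cancel₀ h.ne']
      · rw [lpNorm_smul hp, abs_of_pos (inv_pos.2 h)]
    rwa [inv_mul_le_iff₀ h, mul_comm] at hmem

theorem lpNorm_mulVec_le_of_frobNorm_le (hp : 1 ≤ p) (hq : 1 ≤ q) (hqs : 1 / q + 1 / qs = 1)
    {lam : ℝ} {A : Matrix (Fin m) (Fin n) ℝ} (hA : frobNorm q A ≤ lam) (β : Fin n → ℝ) :
    lpNorm p (A.mulVec β) ≤ lam * discrep m p q * lpNorm qs β := by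
  have hs : 1 ≤ qs := one_le_of_conjugate (by rwa [add_comm])
  calc lpNorm p (A.mulVec β) ≤ discrep m p q * lpNorm q (A.mulVec β) :=
        lpNorm_le_discrep_mul hp hq _
    _ ≤ discrep m p q * (lam * lpNorm qs β) := by
        refine mul_le_mul_of_nonneg_left ?_ (discrep_nonneg hp)
        exact (lpNorm_mulVec_le hq hqs A β).trans
          (mul_le_mul_of_nonneg_right hA (lpNorm_nonneg hs β))
    _ = lam * discrep m p q * lpNorm qs β := by ring

theorem exists_frobNorm_le_lpNorm_mulVec_eq (hp : 1 ≤ p) (hq : 1 ≤ q)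
    (hqs : 1 / q + 1 / qs = 1) {lam : ℝ} (hlam : 0 ≤ lam) (β : Fin n → ℝ) {u : Fin m → ℝ}
    (hu : lpNorm q u = 1) :
    ∃ A : Matrix (Fin m) (Fin n) ℝ, frobNorm q A ≤ lam ∧
      lpNorm p (A.mulVec β) = lam * lpNorm qs β * lpNorm p u := by
  have hs : 1 ≤ qs := one_le_of_conjugate (by rwa [add_comm])
  obtain ⟨v, hv, hvβ⟩ := exists_lpNorm_le_one_sum_mul_eq hqs β
  refine ⟨Matrix.vecMulVec (lam • u) v, ?_, ?_⟩
  · rw [frobNorm_vecMulVec hq, lpNorm_smul hq, hu, abs_of_nonneg hlam, mul_one]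
    exact mul_le_of_le_one_right hlam hv
  · have h : (Matrix.vecMulVec (lam • u) v).mulVec β = (lam * lpNorm qs β) • u := by
      ext i
      simp only [Matrix.mulVec, dotProduct, Matrix.vecMulVec_apply, Pi.smul_apply, smul_eq_mul]
      simp only [mul_assoc, ← Finset.mul_sum, hvβ]
      ring
    rw [h, lpNorm_smul hp, abs_of_nonneg (mul_nonneg hlam (lpNorm_nonneg hs β))]

end Matrix

/-- Regularization upper bound for ℓ_p regression under q-Frobenius uncertainty,
together with the exact worst-case value of ‖Δβ‖_p over the q-Frobenius ball. -/
theorem stmt9 {m n : ℕ} (p q qs : ℝ≥0∞) (hp : 1 ≤ p) (hq : 1 ≤ q)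
    (hqs : 1 / q + 1 / qs = 1) (lam : ℝ) (hlam : 0 < lam) :
    (∀ (z : Fin m → ℝ) (β : Fin n → ℝ),
      sSup {t : ℝ | ∃ Δ : Matrix (Fin m) (Fin n) ℝ, frobNorm q Δ ≤ lam ∧
          t = lpNorm p (z + Δ.mulVec β)} ≤
        lpNorm p z + lam * discrep m p q * lpNorm qs β) ∧
    (∀ β : Fin n → ℝ,
      sSup {t : ℝ | ∃ Δ : Matrix (Fin m) (Fin n) ℝ, frobNorm q Δ ≤ lam ∧
          t = lpNorm p (Δ.mulVec β)} =
        lam * discrep m p q * lpNorm qs β) := by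
  have hs : 1 ≤ qs := one_le_of_conjugate (by rwa [add_comm])
  have hnonneg : ∀ β : Fin n → ℝ, 0 ≤ lam * discrep m p q * lpNorm qs β := fun β =>
    mul_nonneg (mul_nonneg hlam.le (discrep_nonneg hp)) (lpNorm_nonneg hs β)
  refine ⟨fun z β => Real.sSup_le ?_ (add_nonneg (lpNorm_nonneg hp z) (hnonneg β)), fun β => ?_⟩
  · rintro t ⟨A, hA, rfl⟩
    exact (lpNorm_add_le hp _ _).trans
      (add_le_add_right (lpNorm_mulVec_le_of_frobNorm_le hp hq hqs hA β) _)
  · have hub : lam * discrep m p q * lpNorm qs β ∈ upperBounds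
        {t : ℝ | ∃ Δ : Matrix (Fin m) (Fin n) ℝ, frobNorm q Δ ≤ lam ∧
          t = lpNorm p (Δ.mulVec β)} := by
      rintro t ⟨A, hA, rfl⟩
      exact lpNorm_mulVec_le_of_frobNorm_le hp hq hqs hA β
    have hsup : 0 ≤ sSup {t : ℝ | ∃ Δ : Matrix (Fin m) (Fin n) ℝ, frobNorm q Δ ≤ lam ∧
          t = lpNorm p (Δ.mulVec β)} := by
      refine Real.sSup_nonneg ?_
      rintro t ⟨A, -, rfl⟩
      exact lpNorm_nonneg hp _
    refine le_antisymm (Real.sSup_le hub (hnonneg β)) ?_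
    rcases (lpNorm_nonneg hs β).eq_or_lt with h | h
    · rwa [← h, mul_zero]
    · rw [mul_right_comm, ← le_div_iff₀' (mul_pos hlam h)]
      refine Real.sSup_le ?_ (by positivity)
      rintro t ⟨u, hu, rfl⟩
      rw [le_div_iff₀' (mul_pos hlam h)]
      obtain ⟨A, hA, hAβ⟩ :=
        exists_frobNorm_le_lpNorm_mulVec_eq (p := p) hp hq hqs hlam.le β hu
      exact le_csSup ⟨_, hub⟩ ⟨A, hA, hAβ.symm⟩
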